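/- Let Λ be a nonempty right directed partially ordered set, let V' ⊆ V be nonempty open subsets of ℝⁿ, and let Σ ⊆ V. Suppose w = (w_λ)_{λ∈Λ} ∈ J_{Λ,Σ∩V'}(V') and (γ_λ)_{λ∈Λ} is a family in C^∞(V) such that each γ_λ vanishes on an open subset of V containing V∖V'. Then for each λ the function equal to γ_λ·w_λ on V' and to 0 on V∖V' is smooth on V, and the resulting family belongs to J_{Λ,Σ∩V}(V). -/

import Mathlib

open scoped Topology

/-- The `i`-th partial derivative of a function `ℝⁿ → ℝ`. -/
noncomputable def pderivI {n : ℕ} (i : Fin n) (f : (Fin n → ℝ) → ℝ) : (Fin n → ℝ) → ℝ :=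
  fun x => fderiv ℝ f x (Pi.single i 1)

/-- The iterated partial derivative `D^p` associated with a multi-index `p ∈ ℕⁿ`. -/
noncomputable def Dpartial {n : ℕ} (p : Fin n → ℕ) (f : (Fin n → ℝ) → ℝ) : (Fin n → ℝ) → ℝ :=
  (List.finRange n).foldr (fun i g => (pderivI i)^[p i] g) f

/-- The algebra `C^∞(X)` of smooth real-valued functions on (the open set) `X ⊆ ℝⁿ`,
realized as the subalgebra of `(Fin n → ℝ) → ℝ` of functions smooth on `X`. -/
def SmoothA (n : ℕ) (X : Set (Fin n → ℝ)) : Subalgebra ℝ ((Fin n → ℝ) → ℝ) where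
  carrier := {f | ContDiffOn ℝ (⊤ : ℕ∞) f X}
  mul_mem' hf hg := hf.mul hg
  add_mem' hf hg := hf.add hg
  algebraMap_mem' r := contDiffOn_const

/-- The asymptotic vanishing condition defining `J_{Λ,Σ}(U)`, stated for a raw family of
functions: for every `x ∈ U ∖ Σ` there is `λ ∈ Λ` such that all partial derivatives
(including order `0`) of `w_μ` vanish at `x` for all `μ ≥ λ`. -/
def JvanP (Λ : Type*) [PartialOrder Λ] {n : ℕ} (U Sg : Set (Fin n → ℝ))
    (w : Λ → (Fin n → ℝ) → ℝ) : Prop :=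
  ∀ x ∈ U \ Sg, ∃ l : Λ, ∀ m : Λ, l ≤ m → ∀ p : Fin n → ℕ, Dpartial p (w m) x = 0

/-- The asymptotically vanishing set `J_{Λ,Σ}(X)` inside the product ring `(C^∞(X))^Λ`. -/
def Jset (Λ : Type*) [PartialOrder Λ] {n : ℕ} (X Sg : Set (Fin n → ℝ)) :
    Set (Λ → (SmoothA n X)) :=
  {w | JvanP Λ X Sg (fun m => ((w m : (Fin n → ℝ) → ℝ)))}

/-- `J_{Λ,S}(X) = ∪_{Σ ∈ S} J_{Λ,Σ}(X)` for a family `S` of singularity sets. -/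
def JsetFam (Λ : Type*) [PartialOrder Λ] {n : ℕ} (X : Set (Fin n → ℝ))
    (S : Set (Set (Fin n → ℝ))) : Set (Λ → (SmoothA n X)) :=
  ⋃ Sg ∈ S, Jset Λ X Sg

/-- A family `S` of subsets of `X` is admissible : it is nonempty, consists of subsets
of `X`, and any two members have a common upper bound in `S` containing their union. -/
def Admissible {n : ℕ} (X : Set (Fin n → ℝ)) (S : Set (Set (Fin n → ℝ))) : Prop :=
  S.Nonempty ∧ (∀ Sg ∈ S, Sg ⊆ X) ∧ ∀ Sg ∈ S, ∀ Sg' ∈ S, ∃ Sg'' ∈ S, Sg ∪ Sg' ⊆ Sg''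

/-- Right directedness of a partial order. -/
def RightDirected (Λ : Type*) [PartialOrder Λ] : Prop :=
  ∀ a b : Λ, ∃ c : Λ, a ≤ c ∧ b ≤ c


/-- Iterated partial derivative along a list of indices. -/
noncomputable def DLst {n : ℕ} (L : List (Fin n)) (f : (Fin n → ℝ) → ℝ) : (Fin n → ℝ) → ℝ :=
  L.foldr pderivI f

lemma DLst_cons {n : ℕ} (i : Fin n) (L : List (Fin n)) (f : (Fin n → ℝ) → ℝ) :
    DLst (i :: L) f = pderivI i (DLst L f) := rfl

lemma DLst_append {n : ℕ} (L L' : List (Fin n)) (f : (Fin n → ℝ) → ℝ) :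
    DLst (L ++ L') f = DLst L (DLst L' f) := by
  simp [DLst, List.foldr_append]

lemma DLst_replicate {n : ℕ} (i : Fin n) (k : ℕ) (f : (Fin n → ℝ) → ℝ) :
    DLst (List.replicate k i) f = (pderivI i)^[k] f := by
  induction k with
  | zero => rfl
  | succ k ih => rw [List.replicate_succ, DLst_cons, ih, Function.iterate_succ_apply']

lemma Dpartial_eq_DLst {n : ℕ} (p : Fin n → ℕ) (f : (Fin n → ℝ) → ℝ) :
    Dpartial p f = DLst ((List.finRange n).flatMap fun i => List.replicate (p i) i) f := by
  unfold Dpartial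
  induction List.finRange n with
  | nil => rfl
  | cons i l ih =>
    rw [List.foldr_cons, ih, List.flatMap_cons, DLst_append, DLst_replicate]

lemma perm_flatMap {n : ℕ} (L : List (Fin n)) :
    L.Perm ((List.finRange n).flatMap fun i => List.replicate (L.count i) i) := by
  rw [List.perm_iff_count]
  intro a
  rw [List.count_flatMap]
  have : (List.count a ∘ fun i => List.replicate (L.count i) i)
      = fun i => if i = a then L.count a else 0 := by
    funext i
    by_cases h : i = a
    · subst h; simp
    · simp [List.count_replicate, h]
  rw [this, ← List.ofFn_eq_map, List.sum_ofFn]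
  simp

lemma pderivI_smooth {n : ℕ} (i : Fin n) {U : Set (Fin n → ℝ)} (hU : IsOpen U)
    {f : (Fin n → ℝ) → ℝ} (hf : ContDiffOn ℝ (⊤ : ℕ∞) f U) :
    ContDiffOn ℝ (⊤ : ℕ∞) (pderivI i f) U := by
  have h := hf.fderiv_of_isOpen (m := ((⊤ : ℕ∞) : WithTop ℕ∞)) hU (by simp)
  exact h.clm_apply contDiffOn_const

lemma pderivI_congr {n : ℕ} (i : Fin n) {U : Set (Fin n → ℝ)} (hU : IsOpen U)
    {f g : (Fin n → ℝ) → ℝ} (h : Set.EqOn f g U) :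
    Set.EqOn (pderivI i f) (pderivI i g) U := by
  intro x hx
  have : f =ᶠ[𝓝 x] g := h.eventuallyEq_of_mem (hU.mem_nhds hx)
  simp only [pderivI, this.fderiv_eq]

lemma DLst_smooth {n : ℕ} (L : List (Fin n)) {U : Set (Fin n → ℝ)} (hU : IsOpen U)
    {f : (Fin n → ℝ) → ℝ} (hf : ContDiffOn ℝ (⊤ : ℕ∞) f U) :
    ContDiffOn ℝ (⊤ : ℕ∞) (DLst L f) U := by
  induction L with
  | nil => exact hf
  | cons i L ih => exact pderivI_smooth i hU ih

lemma DLst_congr {n : ℕ} (L : List (Fin n)) {U : Set (Fin n → ℝ)} (hU : IsOpen U)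
    {f g : (Fin n → ℝ) → ℝ} (h : Set.EqOn f g U) :
    Set.EqOn (DLst L f) (DLst L g) U := by
  induction L with
  | nil => exact h
  | cons i L ih => exact pderivI_congr i hU ih

lemma diffAt_of {n : ℕ} {U : Set (Fin n → ℝ)} (hU : IsOpen U)
    {f : (Fin n → ℝ) → ℝ} (hf : ContDiffOn ℝ (⊤ : ℕ∞) f U) {x} (hx : x ∈ U) :
    DifferentiableAt ℝ f x :=
  (hf.contDiffAt (hU.mem_nhds hx)).differentiableAt (by simp)

lemma pderivI_comm {n : ℕ} (i j : Fin n) {U : Set (Fin n → ℝ)} (hU : IsOpen U)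
    {f : (Fin n → ℝ) → ℝ} (hf : ContDiffOn ℝ (⊤ : ℕ∞) f U) :
    Set.EqOn (pderivI i (pderivI j f)) (pderivI j (pderivI i f)) U := by
  intro x hx
  have hc := hf.contDiffAt (hU.mem_nhds hx)
  have hs : IsSymmSndFDerivAt ℝ f x := hc.isSymmSndFDerivAt (by
    simp only [minSmoothness_of_isRCLikeNormedField]; exact WithTop.coe_le_coe.2 (le_top : (2 : ℕ∞) ≤ ⊤))
  have h := hf.fderiv_of_isOpen (m := ((⊤ : ℕ∞) : WithTop ℕ∞)) hU (by simp)
  have hd : DifferentiableAt ℝ (fderiv ℝ f) x :=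
    (h.contDiffAt (hU.mem_nhds hx)).differentiableAt (by simp)
  have key : ∀ a b : Fin n, pderivI a (pderivI b f) x
      = fderiv ℝ (fderiv ℝ f) x (Pi.single a 1) (Pi.single b 1) := by
    intro a b
    unfold pderivI
    rw [fderiv_clm_apply hd (differentiableAt_const _)]
    simp
  rw [key, key]
  exact hs _ _

lemma DLst_perm {n : ℕ} {L L' : List (Fin n)} (h : L.Perm L') {U : Set (Fin n → ℝ)}
    (hU : IsOpen U) {f : (Fin n → ℝ) → ℝ} (hf : ContDiffOn ℝ (⊤ : ℕ∞) f U) :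
    Set.EqOn (DLst L f) (DLst L' f) U := by
  induction h with
  | nil => exact fun _ _ => rfl
  | cons i _ ih => exact pderivI_congr i hU ih
  | swap i j l => exact pderivI_comm _ _ hU (DLst_smooth l hU hf)
  | trans _ _ h1 h2 => exact h1.trans h2

lemma DLst_add {n : ℕ} (L : List (Fin n)) {U : Set (Fin n → ℝ)} (hU : IsOpen U)
    {f g : (Fin n → ℝ) → ℝ} (hf : ContDiffOn ℝ (⊤ : ℕ∞) f U)
    (hg : ContDiffOn ℝ (⊤ : ℕ∞) g U) :
    Set.EqOn (DLst L (fun x => f x + g x)) (fun x => DLst L f x + DLst L g x) U := by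
  induction L with
  | nil => exact fun _ _ => rfl
  | cons i L ih =>
    intro x hx
    rw [DLst_cons, pderivI_congr i hU ih hx]
    simp only [pderivI, DLst_cons]
    rw [fderiv_fun_add (diffAt_of hU (DLst_smooth L hU hf) hx)
      (diffAt_of hU (DLst_smooth L hU hg) hx)]
    rfl

lemma DLst_mul_flat {n : ℕ} {U : Set (Fin n → ℝ)} (hU : IsOpen U) {x : Fin n → ℝ}
    (hx : x ∈ U) (L : List (Fin n)) :
    ∀ g f : (Fin n → ℝ) → ℝ, ContDiffOn ℝ (⊤ : ℕ∞) g U → ContDiffOn ℝ (⊤ : ℕ∞) f U →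
      (∀ L', DLst L' f x = 0) → DLst L (fun y => g y * f y) x = 0 := by
  induction L using List.reverseRecOn with
  | nil =>
    intro g f _ _ h
    have := h []
    simp only [DLst, List.foldr_nil] at this ⊢
    rw [this, mul_zero]
  | append_singleton L i ih =>
    intro g f hg hf h
    have hpf := pderivI_smooth i hU hf
    have hpg := pderivI_smooth i hU hg
    have e : Set.EqOn (pderivI i (fun y => g y * f y))
        (fun y => g y * pderivI i f y + pderivI i g y * f y) U := by
      intro y hy
      simp only [pderivI]
      rw [fderiv_fun_mul (diffAt_of hU hg hy) (diffAt_of hU hf hy)]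
      simp [mul_comm]
    rw [DLst_append]
    change DLst L (pderivI i (fun y => g y * f y)) x = 0
    rw [DLst_congr L hU e hx, DLst_add L hU (hg.mul hpf) (hpg.mul hf) hx]
    simp only
    rw [ih g _ hg hpf (fun L' => by simpa [DLst_append, DLst] using h (L' ++ [i])),
      ih _ f hpg hf h, add_zero]

lemma DLst_zero {n : ℕ} (L : List (Fin n)) : DLst L (fun _ => (0 : ℝ)) = fun _ => 0 := by
  induction L with
  | nil => rfl
  | cons i L ih => rw [DLst_cons, ih]; funext x; simp [pderivI]

/-- extension by cutoffs — if `w ∈ J_{Λ,Σ∩V'}(V')` and each `γ_λ` is smooth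
on `V` and vanishes on an open subset of `V` containing `V ∖ V'`, then the termwise
extension by `0` of `γ_λ·w_λ` is smooth on `V` and belongs to `J_{Λ,Σ∩V}(V)`. -/
theorem stmt16 {n : ℕ} (hn : 0 < n)
    (Λ : Type*) [PartialOrder Λ] [Nonempty Λ] (hdir : RightDirected Λ)
    (V' V : Set (Fin n → ℝ)) (hsub : V' ⊆ V)
    (hV'o : IsOpen V') (hV'ne : V'.Nonempty) (hVo : IsOpen V) (hVne : V.Nonempty)
    (Sg : Set (Fin n → ℝ)) (hSg : Sg ⊆ V)
    (w : Λ → (Fin n → ℝ) → ℝ) (hws : ∀ m, ContDiffOn ℝ (⊤ : ℕ∞) (w m) V')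
    (hwJ : JvanP Λ V' (Sg ∩ V') w)
    (γ : Λ → (Fin n → ℝ) → ℝ) (hγs : ∀ m, ContDiffOn ℝ (⊤ : ℕ∞) (γ m) V)
    (hγ0 : ∀ m, ∃ O : Set (Fin n → ℝ), IsOpen O ∧ O ⊆ V ∧ V \ V' ⊆ O ∧ ∀ x ∈ O, γ m x = 0) :
    (∀ m, ContDiffOn ℝ (⊤ : ℕ∞) (V'.indicator (fun x => γ m x * w m x)) V) ∧
    JvanP Λ V (Sg ∩ V) (fun m => V'.indicator (fun x => γ m x * w m x)) := by
  have hO : ∀ m, ∀ x ∈ V \ V', ∃ O : Set (Fin n → ℝ), IsOpen O ∧ x ∈ O ∧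
      Set.EqOn (V'.indicator (fun x => γ m x * w m x)) (fun _ => 0) O := by
    intro m x hx
    obtain ⟨O, hOo, _, hsubO, h0⟩ := hγ0 m
    refine ⟨O, hOo, hsubO hx, fun y hy => ?_⟩
    by_cases hyV : y ∈ V'
    · simp [hyV, h0 y hy]
    · simp [hyV]
  have hE : ∀ m, Set.EqOn (V'.indicator (fun x => γ m x * w m x))
      (fun x => γ m x * w m x) V' := fun m x hx => Set.indicator_of_mem hx _
  refine ⟨fun m x hx => ?_, fun x hx => ?_⟩
  · by_cases hxV : x ∈ V'
    · have h : ContDiffOn ℝ (⊤ : ℕ∞) (fun x => γ m x * w m x) V' :=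
        ((hγs m).mono hsub).mul (hws m)
      exact ((h.congr (hE m)).contDiffAt (hV'o.mem_nhds hxV)).contDiffWithinAt
    · obtain ⟨O, hOo, hxO, h0⟩ := hO m x ⟨hx, hxV⟩
      have h : ContDiffOn ℝ (⊤ : ℕ∞) (fun _ : Fin n → ℝ => (0 : ℝ)) O := contDiffOn_const
      exact ((h.congr h0).contDiffAt (hOo.mem_nhds hxO)).contDiffWithinAt
  · by_cases hxV : x ∈ V'
    · obtain ⟨l, hl⟩ := hwJ x ⟨hxV, fun h => hx.2 ⟨h.1, hx.1⟩⟩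
      refine ⟨l, fun m hm p => ?_⟩
      rw [Dpartial_eq_DLst, DLst_congr _ hV'o (hE m) hxV]
      refine DLst_mul_flat hV'o hxV _ _ _ ((hγs m).mono hsub) (hws m) fun L => ?_
      rw [DLst_perm (perm_flatMap L) hV'o (hws m) hxV, ← Dpartial_eq_DLst (fun i => L.count i)]
      exact hl m hm _
    · obtain ⟨l⟩ := ‹Nonempty Λ›
      refine ⟨l, fun m _ p => ?_⟩
      obtain ⟨O, hOo, hxO, h0⟩ := hO m x ⟨hx.1, hxV⟩
      rw [Dpartial_eq_DLst, DLst_congr _ hOo h0 hxO, DLst_zero]
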